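/- The two half-snake relations hold: (y·X)·(y·X) = −I and (z·X)·(z·X) = −I; i.e., (Y⁻¹X)² = (Z⁻¹X)² = −I. -/

import Mathlib

open Matrix

/-- `ω = exp(2πi/12)`, a primitive 12th root of unity. -/
noncomputable def ω : ℂ := Complex.exp (2 * Real.pi * Complex.I / 12)

/-- The SL₂(ℂ) connection matrix on northeast edges. -/
noncomputable def α : Matrix (Fin 2) (Fin 2) ℂ := !![ω^7, 0; 0, ω^5]

/-- The SL₂(ℂ) connection matrix on northwest edges. -/
noncomputable def β : Matrix (Fin 2) (Fin 2) ℂ := !![ω^7, ω^3; 0, ω^5]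

/-- The SL₂(ℂ) connection matrix on horizontal edges. -/
noncomputable def γ : Matrix (Fin 2) (Fin 2) ℂ := !![ω^5, 0; ω^3, ω^7]

/-- The length-two move `X = β·α`. -/
noncomputable def X : Matrix (Fin 2) (Fin 2) ℂ := β * α

/-- The length-two move `Y = α⁻¹·γ`. -/
noncomputable def Y : Matrix (Fin 2) (Fin 2) ℂ := α⁻¹ * γ

/-- The length-two move `Z = γ⁻¹·β⁻¹`. -/
noncomputable def Z : Matrix (Fin 2) (Fin 2) ℂ := γ⁻¹ * β⁻¹

/-- `x = X⁻¹`. -/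
noncomputable def x : Matrix (Fin 2) (Fin 2) ℂ := X⁻¹

/-- `y = Y⁻¹`. -/
noncomputable def y : Matrix (Fin 2) (Fin 2) ℂ := Y⁻¹

/-- `z = Z⁻¹`. -/
noncomputable def z : Matrix (Fin 2) (Fin 2) ℂ := Z⁻¹

/-- `ω` is a root of the twelfth cyclotomic polynomial `t⁴ - t² + 1`. -/
theorem ω_pow_four : ω ^ 4 = ω ^ 2 - 1 := by
  have h : ω = (√3 : ℝ) / 2 + 1 / 2 * Complex.I := by
    have harg : 2 * Real.pi * Complex.I / 12 = ((Real.pi / 6 : ℝ) : ℂ) * Complex.I := by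
      push_cast
      ring
    rw [ω, harg, Complex.exp_mul_I, ← Complex.ofReal_cos, ← Complex.ofReal_sin,
      Real.cos_pi_div_six, Real.sin_pi_div_six]
    push_cast
    ring
  have h3 : ((√3 : ℝ) : ℂ) ^ 2 = 3 := by
    rw [← Complex.ofReal_pow, Real.sq_sqrt (by norm_num)]
    norm_num
  have hsq : ω ^ 2 = 1 / 2 + (√3 : ℝ) / 2 * Complex.I := by
    rw [h]
    linear_combination h3 / 4 + Complex.I_sq / 4
  calc ω ^ 4 = (ω ^ 2) ^ 2 := by ring
    _ = ω ^ 2 - 1 := by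
      rw [hsq]
      linear_combination Complex.I ^ 2 / 4 * h3 + 3 / 4 * Complex.I_sq

theorem ω_pow_six : ω ^ 6 = -1 := by
  linear_combination (ω ^ 2 + 1) * ω_pow_four

theorem γ_inv : γ⁻¹ = !![ω ^ 7, 0; -ω ^ 3, ω ^ 5] := by
  apply Matrix.inv_eq_right_inv
  ext i j
  fin_cases i <;> fin_cases j <;> simp [γ, Matrix.mul_apply, Fin.sum_univ_two]
  · linear_combination (ω ^ 6 - 1) * ω_pow_six
  · ring
  · linear_combination (ω ^ 6 - 1) * ω_pow_six

theorem isUnit_det_α : IsUnit α.det := by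
  have h : α.det = 1 := by
    rw [α, Matrix.det_fin_two_of]
    linear_combination (ω ^ 6 - 1) * ω_pow_six
  simp [h]

theorem isUnit_det_β : IsUnit β.det := by
  have h : β.det = 1 := by
    rw [β, Matrix.det_fin_two_of]
    linear_combination (ω ^ 6 - 1) * ω_pow_six
  simp [h]

theorem isUnit_det_γ : IsUnit γ.det := by
  have h : γ.det = 1 := by
    rw [γ, Matrix.det_fin_two_of]
    linear_combination (ω ^ 6 - 1) * ω_pow_six
  simp [h]

theorem y_eq : y = γ⁻¹ * α := by
  rw [y, Y, Matrix.mul_inv_rev, Matrix.nonsing_inv_nonsing_inv _ isUnit_det_α]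

theorem z_eq : z = β * γ := by
  rw [z, Z, Matrix.mul_inv_rev, Matrix.nonsing_inv_nonsing_inv _ isUnit_det_γ,
    Matrix.nonsing_inv_nonsing_inv _ isUnit_det_β]

theorem y_mul_X : y * X = !![ω ^ 4, -ω ^ 4; -1, -ω ^ 4] := by
  rw [y_eq, γ_inv, X, α, β]
  ext i j
  fin_cases i <;> fin_cases j <;> simp [Matrix.mul_apply, Fin.sum_univ_two] <;>
    grind [ω_pow_four]

theorem z_mul_X : z * X = !![0, -ω ^ 2; -ω ^ 4, 0] := by
  rw [z_eq, X, α, β, γ]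
  ext i j
  fin_cases i <;> fin_cases j <;> simp [Matrix.mul_apply, Fin.sum_univ_two] <;>
    grind [ω_pow_four]

/-- The two half-snake relations: `(y·X)² = (z·X)² = -I`. -/
theorem half_snake_relations :
    (y * X) * (y * X) = -(1 : Matrix (Fin 2) (Fin 2) ℂ) ∧
    (z * X) * (z * X) = -(1 : Matrix (Fin 2) (Fin 2) ℂ) := by
  rw [y_mul_X, z_mul_X]
  constructor <;> ext i j <;> fin_cases i <;> fin_cases j <;>
    simp [Matrix.mul_apply, Fin.sum_univ_two] <;>
    grind [ω_pow_four]
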